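/- There exist universal constants c_1, c_2 > 0 such that for every integer d ≥ 1, every convex body B in ℝ^d, and every real number α with d/2 < α < d, one has g_α(B) ≤ c_1 · (d^d / (α^α (d − α)^{d − α})) · 2^d · e^{−c_2 √d}. -/

import Mathlib

open Set MeasureTheory Pointwise

/-- A convex body: a compact convex set with nonempty interior. -/
def IsConvexBody {E : Type*} [NormedAddCommGroup E] [NormedSpace ℝ E] (B : Set E) : Prop :=
  Convex ℝ B ∧ IsCompact B ∧ (interior B).Nonempty

/-- `gCov α B` is the infimum of `∑ λᵢ^α` over all finite translative coverings of `B`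
by homothets `xᵢ + λᵢ • B` with `λᵢ ∈ (0,1)`. -/
noncomputable def gCov {E : Type*} [NormedAddCommGroup E] [NormedSpace ℝ E]
    (α : ℝ) (B : Set E) : ℝ :=
  sInf {s : ℝ | ∃ (k : ℕ) (lam : Fin k → ℝ) (x : Fin k → E),
    (∀ i, lam i ∈ Set.Ioo (0 : ℝ) 1) ∧
    B ⊆ (⋃ i, x i +ᵥ lam i • B) ∧
    s = ∑ i, lam i ^ α}

theorem IsCompact.sub_set {E : Type*} [AddGroup E] [TopologicalSpace E]
    [IsTopologicalAddGroup E] {B C : Set E} (hB : IsCompact B) (hC : IsCompact C) :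
    IsCompact (B - C) := by
  rw [sub_eq_add_neg]; exact hB.add hC.neg

theorem measure_setOf_mem_sub {E : Type*} [AddGroup E] [MeasurableSpace E]
    [MeasurableAdd E] (μ : Measure E) [μ.IsAddRightInvariant] (t : E) (C : Set E) :
    μ {y | y - t ∈ C} = μ C := by
  have : {y | y - t ∈ C} = (fun y => y + -t) ⁻¹' C := by
    ext y; simp [sub_eq_add_neg]
  rw [this, measure_preimage_add_right]

theorem nonempty_of_measureReal_pos {E : Type*} [MeasurableSpace E] (μ : Measure E) {B : Set E}
    (h : 0 < μ.real B) : B.Nonempty := by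
  by_contra hne
  rw [Set.not_nonempty_iff_eq_empty] at hne
  simp [hne] at h

section Volume

variable {E : Type*} [NormedAddCommGroup E] [NormedSpace ℝ E] [FiniteDimensional ℝ E]
  [MeasurableSpace E] [BorelSpace E]

open Module

theorem measureReal_smul_of_nonneg (μ : Measure E) [μ.IsAddHaarMeasure] {r : ℝ} (hr : 0 ≤ r)
    (s : Set E) : μ.real (r • s) = r ^ finrank ℝ E * μ.real s := by
  rw [measureReal_def, Measure.addHaar_smul_of_nonneg μ hr, ENNReal.toReal_mul,
    ENNReal.toReal_ofReal (by positivity), measureReal_def]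

theorem measure_setOf_sub_mem (μ : Measure E) [μ.IsAddHaarMeasure] (t : E) (C : Set E) :
    μ {y | t - y ∈ C} = μ C := by
  have : {y | t - y ∈ C} = (fun y => y + -t) ⁻¹' (-C) := by
    ext y; simp [sub_eq_add_neg]
  rw [this, measure_preimage_add_right, Measure.measure_neg]

theorem measureReal_setOf_sub_mem (μ : Measure E) [μ.IsAddHaarMeasure] (t : E) (C : Set E) :
    μ.real {y | t - y ∈ C} = μ.real C := by
  rw [measureReal_def, measure_setOf_sub_mem, measureReal_def]

theorem measureReal_le_measureReal_sub (μ : Measure E) [μ.IsAddHaarMeasure] {B C : Set E}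
    (hne : B.Nonempty) (hB : IsCompact B) (hC : IsCompact C) :
    μ.real C ≤ μ.real (B - C) := by
  obtain ⟨b, hb⟩ := hne
  rw [← measureReal_setOf_sub_mem μ b]
  refine measureReal_mono ?_ (hB.sub_set hC).measure_lt_top.ne
  intro y hy
  exact ⟨b, hb, b - y, hy, by simp⟩

/-- The convolution of two indicator functions has integral the product of the measures. -/
theorem lintegral_measure_inter_sub_mem (μ : Measure E) [μ.IsAddHaarMeasure] {B C : Set E}
    (hB : MeasurableSet B) (hC : MeasurableSet C) :
    ∫⁻ x, μ {z | z ∈ B ∧ x - z ∈ C} ∂μ = μ B * μ C := by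
  have h1 : ∀ x, μ {z | z ∈ B ∧ x - z ∈ C} =
      ∫⁻ z, B.indicator 1 z * C.indicator 1 (x - z) ∂μ := by
    intro x
    have hm : MeasurableSet {z | z ∈ B ∧ x - z ∈ C} :=
      hB.inter (hC.preimage (measurable_const.sub measurable_id))
    rw [← lintegral_indicator_one hm]
    refine lintegral_congr fun z => ?_
    by_cases h : z ∈ B <;> by_cases h' : x - z ∈ C <;> simp [h, h']
  have mB : Measurable (B.indicator (1 : E → ENNReal)) := measurable_one.indicator hB
  have mC : Measurable (C.indicator (1 : E → ENNReal)) := measurable_one.indicator hC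
  simp_rw [h1]
  rw [lintegral_lintegral_swap (by fun_prop)]
  have h2 : ∀ z, ∫⁻ x, B.indicator (1 : E → ENNReal) z * C.indicator 1 (x - z) ∂μ =
      B.indicator 1 z * μ C := by
    intro z
    rw [lintegral_const_mul _ (by fun_prop),
      lintegral_sub_right_eq_self (C.indicator (1 : E → ENNReal)),
      lintegral_indicator_one hC]
  simp_rw [h2]
  rw [lintegral_mul_const _ mB, lintegral_indicator_one hB]

/-- A Rogers-Shephard inequality for `B - s² B`. -/
theorem measureReal_sub_sq_smul_le (μ : Measure E) [μ.IsAddHaarMeasure] {B : Set E}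
    (hc : Convex ℝ B) (hB : IsCompact B) (h0 : 0 < μ.real B) {s : ℝ} (hs : 0 < s) :
    μ.real (B - s ^ 2 • B) ≤ ((1 + s) ^ 2) ^ finrank ℝ E * μ.real B := by
  have h1s : 0 < 1 + s := by linarith
  set C : Set E := -(s • B) with hCdef
  have hC : IsCompact C := (hB.smul s).neg
  have hI := lintegral_measure_inter_sub_mem μ hB.measurableSet hC.measurableSet
  set D : Set E := (1 + s)⁻¹ • (B - s ^ 2 • B) with hD
  have hDc : IsCompact D := (hB.sub_set (hB.smul _)).smul _
  have key : ∀ x ∈ D, μ ((s / (1 + s)) • B) ≤ μ {z | z ∈ B ∧ x - z ∈ C} := by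
    rintro x ⟨_, ⟨b, hb, _, ⟨b', hb', rfl⟩, rfl⟩, rfl⟩
    rw [← measure_setOf_mem_sub μ ((1 + s)⁻¹ • b)]
    refine measure_mono ?_
    rintro z ⟨w, hw, hz⟩
    have hz' : z = (1 + s)⁻¹ • b + (s / (1 + s)) • w := by
      simp only at hz; rw [hz]; abel
    refine ⟨?_, ?_⟩
    · rw [hz']
      exact hc hb hw (by positivity) (by positivity) (by field_simp)
    · rw [hCdef, Set.mem_neg]
      refine ⟨(s / (1 + s)) • b' + (1 + s)⁻¹ • w, hc hb' hw (by positivity) (by positivity)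
        (by field_simp; ring), ?_⟩
      rw [hz']
      simp only [smul_add, smul_sub, smul_smul, neg_sub]
      match_scalars <;> field_simp
      ring
  have h2 : μ ((s / (1 + s)) • B) * μ D ≤ μ B * μ C := by
    rw [← hI, ← setLIntegral_const]
    exact (setLIntegral_mono' hDc.measurableSet key).trans (setLIntegral_le_lintegral _ _)
  have h3 := ENNReal.toReal_mono (ENNReal.mul_ne_top hB.measure_lt_top.ne hC.measure_lt_top.ne) h2
  rw [ENNReal.toReal_mul, ENNReal.toReal_mul, ← measureReal_def, ← measureReal_def,
    ← measureReal_def, ← measureReal_def, hD, hCdef, measureReal_smul_of_nonneg μ (by positivity),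
    measureReal_smul_of_nonneg μ (by positivity)] at h3
  have h4 : μ.real (-(s • B)) = s ^ finrank ℝ E * μ.real B := by
    rw [measureReal_def, Measure.measure_neg, ← measureReal_def,
      measureReal_smul_of_nonneg μ hs.le]
  rw [h4, div_pow, inv_pow] at h3
  have h5 : 0 < s ^ finrank ℝ E := by positivity
  have h6 : 0 < (1 + s) ^ finrank ℝ E := by positivity
  rw [← pow_mul, mul_comm 2, pow_mul]
  generalize s ^ finrank ℝ E = p at *
  generalize (1 + s) ^ finrank ℝ E = q at *
  field_simp at h3
  exact h3

/-- A convex body meets some point reflection of itself in a large set. The proof compares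
the `L²` norms of the convolutions of the indicator of `B` with the indicators of `B` and
of `-B`, which are equal. -/
theorem measure_inter_reflection_energy (μ : Measure E) [μ.IsAddHaarMeasure] {B : Set E}
    (hc : Convex ℝ B) (hB : IsCompact B) {m : ENNReal}
    (hm : ∀ x, μ {z | z ∈ B ∧ x - z ∈ B} ≤ m) :
    (μ ((2 / 3 : ℝ) • B)) ^ 2 * μ ((1 / 3 : ℝ) • (B - B)) ≤ m * (μ B * μ B) := by
  have mB : Measurable (B.indicator (1 : E → ENNReal)) :=
    measurable_one.indicator hB.measurableSet
  set f : E → ENNReal := B.indicator 1 with hf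
  set G : E → ENNReal := fun x => ∫⁻ z, f z * f (z - x) ∂μ with hG
  set F : E → ENNReal := fun x => ∫⁻ z, f z * f (x - z) ∂μ with hF
  have hFeq : ∀ x, F x = μ {z | z ∈ B ∧ x - z ∈ B} := by
    intro x
    have hm : MeasurableSet {z | z ∈ B ∧ x - z ∈ B} :=
      hB.measurableSet.inter (hB.measurableSet.preimage (measurable_const.sub measurable_id))
    rw [← lintegral_indicator_one hm]
    refine lintegral_congr fun z => ?_
    by_cases h : z ∈ B <;> by_cases h' : x - z ∈ B <;> simp [hf, h, h']
  have hGeq : ∀ x, G x = μ {z | z ∈ B ∧ z - x ∈ B} := by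
    intro x
    have hm : MeasurableSet {z | z ∈ B ∧ z - x ∈ B} :=
      hB.measurableSet.inter (hB.measurableSet.preimage (measurable_id.sub measurable_const))
    rw [← lintegral_indicator_one hm]
    refine lintegral_congr fun z => ?_
    by_cases h : z ∈ B <;> by_cases h' : z - x ∈ B <;> simp [hf, h, h']
  have mG : Measurable G := by
    refine Measurable.lintegral_prod_right' (f := fun p : E × E => f p.2 * f (p.2 - p.1)) ?_
    fun_prop
  have mF : Measurable F := by
    refine Measurable.lintegral_prod_right' (f := fun p : E × E => f p.2 * f (p.1 - p.2)) ?_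
    fun_prop
  have hFint : ∫⁻ x, F x ∂μ = μ B * μ B := by
    simp_rw [hFeq]; exact lintegral_measure_inter_sub_mem μ hB.measurableSet hB.measurableSet
  have hD : IsCompact ((1 / 3 : ℝ) • (B - B)) := (hB.sub_set hB).smul _
  have hGlow : ∀ x ∈ (1 / 3 : ℝ) • (B - B), μ ((2 / 3 : ℝ) • B) ≤ G x := by
    rintro x ⟨_, ⟨b, hb, b', hb', rfl⟩, rfl⟩
    rw [hGeq, ← measure_setOf_mem_sub μ ((1 / 3 : ℝ) • b)]
    refine measure_mono ?_
    rintro z ⟨w, hw, hz⟩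
    have hz' : z = (1 / 3 : ℝ) • b + (2 / 3 : ℝ) • w := by
      simp only at hz; rw [hz]; abel
    refine ⟨?_, ?_⟩
    · rw [hz']
      exact hc hb hw (by norm_num) (by norm_num) (by norm_num)
    · have : z - (1 / 3 : ℝ) • (b - b') = (1 / 3 : ℝ) • b' + (2 / 3 : ℝ) • w := by
        rw [hz', smul_sub]; abel
      simp only
      rw [this]
      exact hc hb' hw (by norm_num) (by norm_num) (by norm_num)
  have hneg : ∀ x ∈ (1 / 3 : ℝ) • (B - B), -x ∈ (1 / 3 : ℝ) • (B - B) := by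
    rintro x ⟨_, ⟨b, hb, b', hb', rfl⟩, rfl⟩
    exact ⟨b' - b, ⟨b', hb', b, hb, rfl⟩, by simp only [smul_sub, neg_sub]⟩
  have hlow : (μ ((2 / 3 : ℝ) • B)) ^ 2 * μ ((1 / 3 : ℝ) • (B - B)) ≤
      ∫⁻ x, G x * G (-x) ∂μ := by
    rw [← setLIntegral_const]
    refine (setLIntegral_mono' hD.measurableSet fun x hx => ?_).trans
      (setLIntegral_le_lintegral _ _)
    rw [pow_two]
    exact mul_le_mul' (hGlow x hx) (hGlow _ (hneg x hx))
  have hup : ∫⁻ x, F x * F x ∂μ ≤ m * (μ B * μ B) := by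
    rw [← hFint, ← lintegral_const_mul _ mF]
    refine lintegral_mono fun x => mul_le_mul' ?_ le_rfl
    rw [hFeq]; exact hm x
  have heq : ∫⁻ x, G x * G (-x) ∂μ = ∫⁻ x, F x * F x ∂μ := by
    have e1 : ∀ x, G x * G (-x) = ∫⁻ a, f a * f (a + x) * G x ∂μ := by
      intro x
      rw [lintegral_mul_const _ (by fun_prop), mul_comm]
      simp [hG, sub_neg_eq_add]
    have e2 : ∀ x, F x * F x = ∫⁻ a, f a * f (x - a) * F x ∂μ := by
      intro x
      rw [lintegral_mul_const _ (by fun_prop)]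
    have e3 : ∀ a, ∫⁻ x, f a * f (a + x) * G x ∂μ = ∫⁻ b, f a * f b * G (b - a) ∂μ := by
      intro a
      rw [← lintegral_add_left_eq_self (fun b => f a * f b * G (b - a)) a]
      simp
    have e4 : ∀ a, ∫⁻ x, f a * f (x - a) * F x ∂μ = ∫⁻ b, f a * f b * G (b - a) ∂μ := by
      intro a
      have : ∀ x, f a * f (x - a) * F x = ∫⁻ b, f a * f (x - a) * (f b * f (x - b)) ∂μ := by
        intro x; rw [lintegral_const_mul _ (by fun_prop)]
      simp_rw [this]
      rw [lintegral_lintegral_swap (by fun_prop)]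
      refine lintegral_congr fun b => ?_
      have e5 : G (b - a) = ∫⁻ x, f (x - a) * f (x - b) ∂μ := by
        simp only [hG]
        rw [← lintegral_sub_right_eq_self (fun z => f z * f (z - (b - a))) a]
        simp [sub_sub]
      rw [e5, ← lintegral_const_mul _ (by fun_prop)]
      refine lintegral_congr fun x => ?_
      ring
    refine (lintegral_congr e1).trans ((lintegral_lintegral_swap (by fun_prop)).trans ?_)
    refine Eq.trans ?_
      ((lintegral_congr e2).trans (lintegral_lintegral_swap (by fun_prop))).symm
    exact lintegral_congr fun a => (e3 a).trans (e4 a).symm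
  exact hlow.trans (heq.trans_le hup)

/-- A convex body meets some point reflection of itself in a large set. -/
theorem exists_measureReal_inter_reflection_ge (μ : Measure E) [μ.IsAddHaarMeasure] {B : Set E}
    (hc : Convex ℝ B) (hB : IsCompact B) (h0 : 0 < μ.real B) (hn : 1 ≤ finrank ℝ E) :
    ∃ x : E, (5 / 34 : ℝ) ^ finrank ℝ E * μ.real (B - B) ≤ μ.real {z | z ∈ B ∧ x - z ∈ B} := by
  by_contra! hcon
  have hBB := measureReal_le_measureReal_sub μ (nonempty_of_measureReal_pos μ h0) hB hB
  set V := μ.real (B - B) with hV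
  have key := measure_inter_reflection_energy μ hc hB
    (m := ENNReal.ofReal ((5 / 34 : ℝ) ^ finrank ℝ E * V)) (fun x => by
      have hfin : μ {z | z ∈ B ∧ x - z ∈ B} ≠ ⊤ :=
        ((measure_mono fun z hz => hz.1).trans_lt hB.measure_lt_top).ne
      rw [← ENNReal.ofReal_toReal hfin]
      exact ENNReal.ofReal_le_ofReal (hcon x).le)
  have h3 := ENNReal.toReal_mono (ENNReal.mul_ne_top ENNReal.ofReal_ne_top
    (ENNReal.mul_ne_top hB.measure_lt_top.ne hB.measure_lt_top.ne)) key
  rw [ENNReal.toReal_mul, ENNReal.toReal_mul, ENNReal.toReal_mul, ENNReal.toReal_pow,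
    ENNReal.toReal_ofReal (by positivity), ← measureReal_def, ← measureReal_def,
    ← measureReal_def, measureReal_smul_of_nonneg μ (by norm_num),
    measureReal_smul_of_nonneg μ (by norm_num), ← hV] at h3
  have h4 : (5 / 34 : ℝ) ^ finrank ℝ E < (4 / 27 : ℝ) ^ finrank ℝ E :=
    pow_lt_pow_left₀ (by norm_num) (by norm_num) (by omega)
  have h5 : (4 / 27 : ℝ) ^ finrank ℝ E = ((2 / 3 : ℝ) ^ finrank ℝ E) ^ 2 *
      (1 / 3 : ℝ) ^ finrank ℝ E := by
    rw [← pow_mul, mul_comm _ 2, pow_mul, ← mul_pow]; norm_num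
  have hV0 : 0 < V := h0.trans_le hBB
  have h6 : 0 < μ.real B * μ.real B * V := by positivity
  have h7 : (4 / 27 : ℝ) ^ finrank ℝ E * (μ.real B * μ.real B * V) ≤
      (5 / 34 : ℝ) ^ finrank ℝ E * (μ.real B * μ.real B * V) := by
    rw [h5]; linarith
  exact absurd (le_of_mul_le_mul_right h7 h6) (not_le.mpr h4)

end Volume

section Covering

variable {E : Type*} [NormedAddCommGroup E] [NormedSpace ℝ E] [FiniteDimensional ℝ E]
  [MeasurableSpace E] [BorelSpace E]

open Module

open Classical in
/-- Some translate of `C` covers at least the average number of points of a finite set. -/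
theorem exists_translate_card_ge (μ : Measure E) [μ.IsAddHaarMeasure] {C Y : Set E}
    (hC : MeasurableSet C) (hY : MeasurableSet Y) (hY0 : μ Y ≠ 0)
    (S : Finset E) (hS : ∀ t ∈ S, ∀ y, t - y ∈ C → y ∈ Y) :
    ∃ y, (S.card : ℝ) * (μ.real C / μ.real Y) ≤ ((S.filter fun t => t - y ∈ C).card : ℝ) := by
  have hm : ∀ t, MeasurableSet {y | t - y ∈ C} := fun t =>
    hC.preimage (measurable_const.sub measurable_id)
  have hint : ∫⁻ y in Y, ∑ t ∈ S, {y | t - y ∈ C}.indicator (1 : E → ENNReal) y ∂μ =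
      S.card * μ C := by
    rw [lintegral_finsetSum _ fun t _ => measurable_one.indicator (hm t), Finset.sum_congr rfl,
      Finset.sum_const, nsmul_eq_mul]
    intro t ht
    rw [lintegral_indicator_one (hm t), Measure.restrict_apply (hm t),
      Set.inter_eq_left.mpr (show {y | t - y ∈ C} ⊆ Y from fun y hy => hS t ht y hy),
      measure_setOf_sub_mem]
  have hsum : ∀ y, ∑ t ∈ S, {y | t - y ∈ C}.indicator (1 : E → ENNReal) y =
      (S.filter fun t => t - y ∈ C).card := by
    intro y
    rw [Finset.card_filter, Nat.cast_sum]
    refine Finset.sum_congr rfl fun t _ => ?_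
    by_cases h : t - y ∈ C <;> simp [h]
  by_cases hCfin : μ C = ⊤
  · refine ⟨0, ?_⟩
    simp [measureReal_def, hCfin]
  obtain ⟨y, -, hy⟩ := exists_setLAverage_le (μ := μ) (s := Y)
    (f := fun y => ∑ t ∈ S, {y | t - y ∈ C}.indicator (1 : E → ENNReal) y) hY0
    hY.nullMeasurableSet (by
      rw [hint]; exact ENNReal.mul_ne_top (ENNReal.natCast_ne_top _) hCfin)
  refine ⟨y, ?_⟩
  rw [setLAverage_eq, hint, hsum] at hy
  have h3 := ENNReal.toReal_mono (ENNReal.natCast_ne_top _) hy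
  rw [ENNReal.toReal_div, ENNReal.toReal_mul, ENNReal.toReal_natCast,
    ENNReal.toReal_natCast] at h3
  rwa [measureReal_def, measureReal_def, ← mul_div_assoc]

open Classical in
/-- Iterating the greedy choice leaves a geometrically small number of uncovered points. -/
theorem exists_translates_uncovered_le (μ : Measure E) [μ.IsAddHaarMeasure] {C Y : Set E}
    (hC : MeasurableSet C) (hY : MeasurableSet Y) (hY0 : μ Y ≠ 0)
    (hCY : μ.real C ≤ μ.real Y)
    (T : Finset E) (hT : ∀ t ∈ T, ∀ y, t - y ∈ C → y ∈ Y) (N : ℕ) :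
    ∃ y : Fin N → E, ((T.filter fun t => ∀ i, t - y i ∉ C).card : ℝ) ≤
      (1 - μ.real C / μ.real Y) ^ N * T.card := by
  induction N with
  | zero => exact ⟨Fin.elim0, by simp⟩
  | succ N ih =>
    obtain ⟨y, hy⟩ := ih
    set S := T.filter fun t => ∀ i, t - y i ∉ C with hSdef
    obtain ⟨z, hz⟩ := exists_translate_card_ge μ hC hY hY0 S
      fun t ht => hT t (Finset.mem_filter.mp ht).1
    refine ⟨Fin.cons z y, ?_⟩
    have e1 : (T.filter fun t => ∀ i, t - (Fin.cons z y : Fin (N + 1) → E) i ∉ C) =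
        S.filter fun t => ¬ (t - z ∈ C) := by
      ext t
      simp only [hSdef, Finset.mem_filter, Fin.forall_fin_succ, Fin.cons_zero, Fin.cons_succ]
      tauto
    have e2 := Finset.card_filter_add_card_filter_not (s := S) (fun t => t - z ∈ C)
    have e3 : ((S.filter fun t => t - z ∈ C).card : ℝ) +
        ((S.filter fun t => ¬ (t - z ∈ C)).card : ℝ) = S.card := by exact_mod_cast e2
    have hp : 0 ≤ 1 - μ.real C / μ.real Y := by
      have : μ.real C / μ.real Y ≤ 1 := div_le_one_of_le₀ hCY measureReal_nonneg
      linarith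
    rw [e1, pow_succ]
    nlinarith [mul_le_mul_of_nonneg_left hy hp]

/-- A finite set can be covered by few translates of a set of positive measure. -/
theorem exists_translates_cover_finset (μ : Measure E) [μ.IsAddHaarMeasure] {C Y : Set E}
    (hC : MeasurableSet C) (hY : MeasurableSet Y)
    (hC0 : 0 < μ.real C) (hCY : μ.real C ≤ μ.real Y)
    (T : Finset E) (hT : ∀ t ∈ T, ∀ y, t - y ∈ C → y ∈ Y) (hTne : T.Nonempty) :
    ∃ (N : ℕ) (y : Fin N → E), (∀ t ∈ T, ∃ i, t - y i ∈ C) ∧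
      (N : ℝ) ≤ 1 + μ.real Y / μ.real C * Real.log T.card := by
  classical
  have hY0 : 0 < μ.real Y := hC0.trans_le hCY
  have hTc : (1 : ℝ) ≤ T.card := by exact_mod_cast hTne.card_pos
  have hlog : 0 ≤ Real.log T.card := Real.log_nonneg hTc
  set p := μ.real C / μ.real Y with hp
  have hp0 : 0 < p := div_pos hC0 hY0
  set L := μ.real Y / μ.real C * Real.log T.card with hL
  have hpL : p * L = Real.log T.card := by rw [hp, hL]; field_simp
  have hL0 : 0 ≤ L := by positivity
  obtain ⟨y, hy⟩ := exists_translates_uncovered_le μ hC hY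
    (fun h => by simp [measureReal_def, h] at hY0) hCY T hT (⌊L⌋₊ + 1)
  refine ⟨_, y, ?_, ?_⟩
  · have hlt : (1 - p) ^ (⌊L⌋₊ + 1) * (T.card : ℝ) < 1 := by
      have h1 : (1 - p) ^ (⌊L⌋₊ + 1) ≤ Real.exp (-p) ^ (⌊L⌋₊ + 1) := by
        refine pow_le_pow_left₀ ?_ ?_ _
        · have : p ≤ 1 := div_le_one_of_le₀ hCY measureReal_nonneg
          linarith
        · have := Real.add_one_le_exp (-p); linarith
      have h2 : Real.exp (-p) ^ (⌊L⌋₊ + 1) < (T.card : ℝ)⁻¹ := by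
        rw [← Real.exp_nat_mul, ← Real.exp_log (x := (T.card : ℝ)) (by positivity),
          ← Real.exp_neg, Real.exp_lt_exp, ← hpL]
        have := Nat.lt_floor_add_one L
        push_cast
        nlinarith
      calc _ ≤ Real.exp (-p) ^ (⌊L⌋₊ + 1) * (T.card : ℝ) := by gcongr
        _ < (T.card : ℝ)⁻¹ * T.card := by gcongr
        _ = 1 := by field_simp
    have h0 : (T.filter fun t => ∀ i, t - y i ∉ C).card = 0 := by
      have := hy.trans_lt hlt
      have h1 : (T.filter fun t => ∀ i, t - y i ∉ C).card < 1 := by exact_mod_cast this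
      omega
    intro t ht
    by_contra! hcon
    rw [Finset.card_eq_zero] at h0
    have : t ∈ T.filter fun t => ∀ i, t - y i ∉ C := Finset.mem_filter.mpr ⟨ht, hcon⟩
    simp [h0] at this
  · push_cast
    linarith [Nat.floor_le hL0]

/-- A volume packing argument: a convex set has a small net with respect to the difference body
of a subset. -/
theorem exists_finset_net (μ : Measure E) [μ.IsAddHaarMeasure] {B K : Set E}
    (hc : Convex ℝ B) (hB : IsCompact B) (hK : IsCompact K) (hKB : K ⊆ B) (hK0 : 0 < μ.real K)
    {r : ℝ} (hr : 0 < r) :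
    ∃ T : Finset E, ↑T ⊆ B ∧ (∀ b ∈ B, ∃ t ∈ T, ∃ k ∈ K, ∃ k' ∈ K, b = t + r • (k' - k)) ∧
      (T.card : ℝ) * (r ^ finrank ℝ E * μ.real K) ≤ (1 + r) ^ finrank ℝ E * μ.real B := by
  classical
  let P : Finset E → Prop := fun T => ↑T ⊆ B ∧
    (↑T : Set E).PairwiseDisjoint fun t => t +ᵥ r • K
  have hrK : IsCompact (r • K) := hK.smul r
  have hbound : ∀ T, P T →
      (T.card : ℝ) * (r ^ finrank ℝ E * μ.real K) ≤ (1 + r) ^ finrank ℝ E * μ.real B := by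
    rintro T ⟨hTB, hTd⟩
    rw [← measureReal_smul_of_nonneg μ hr.le, ← measureReal_smul_of_nonneg μ (by positivity)]
    have h1 : μ.real (⋃ t ∈ T, (t +ᵥ r • K)) = T.card * μ.real (r • K) := by
      rw [measureReal_biUnion_finset hTd
        (fun t _ => (hrK.vadd t).measurableSet)
        (fun t _ => (hrK.vadd t).measure_lt_top.ne)]
      simp [measureReal_def, measure_vadd]
    rw [← h1]
    refine measureReal_mono ?_ (hB.smul _).measure_lt_top.ne
    intro z hz
    simp only [Set.mem_iUnion] at hz
    obtain ⟨t, ht, _, ⟨k, hk, rfl⟩, rfl⟩ := hz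
    rw [hc.add_smul zero_le_one hr.le, one_smul]
    exact ⟨t, hTB ht, r • k, ⟨k, hKB hk, rfl⟩, rfl⟩
  have hpos : 0 < r ^ finrank ℝ E * μ.real K := by positivity
  by_contra! hcon
  have hall : ∀ m : ℕ, ∃ T, P T ∧ T.card = m := by
    intro m
    induction m with
    | zero => exact ⟨∅, ⟨by simp, by simp⟩, rfl⟩
    | succ m ih =>
      obtain ⟨T, hT, hTm⟩ := ih
      have : ¬ ∀ b ∈ B, ∃ t ∈ T, ∃ k ∈ K, ∃ k' ∈ K, b = t + r • (k' - k) := fun h =>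
        absurd (hbound T hT) (not_le.mpr (hcon T hT.1 h))
      push Not at this
      obtain ⟨b, hb, hbT⟩ := this
      obtain ⟨k0, hk0⟩ := nonempty_of_measureReal_pos μ hK0
      have hbn : b ∉ T := fun h => hbT b h k0 hk0 k0 hk0 (by simp)
      refine ⟨insert b T, ⟨?_, ?_⟩, by rw [Finset.card_insert_of_notMem hbn, hTm]⟩
      · rw [Finset.coe_insert]; exact Set.insert_subset hb hT.1
      · rw [Finset.coe_insert]
        refine hT.2.insert fun t ht _ => ?_
        rw [Set.disjoint_left]
        rintro _ ⟨_, ⟨k, hk, rfl⟩, rfl⟩ ⟨_, ⟨k', hk', rfl⟩, he⟩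
        refine hbT t ht k hk k' hk' ?_
        simp only [vadd_eq_add] at he
        rw [smul_sub, ← add_sub_assoc, he]; abel
  obtain ⟨m, hm⟩ := exists_nat_gt ((1 + r) ^ finrank ℝ E * μ.real B /
    (r ^ finrank ℝ E * μ.real K))
  obtain ⟨T, hT, hTm⟩ := hall m
  have := hbound T hT
  rw [div_lt_iff₀ hpos, ← hTm] at hm
  linarith

/-- If a convex body `K ⊆ B` contains a large intersection of `B` with a point reflection of
itself, then the covering number of `B` by copies of `c • B` is controlled by the volume ratio of
`B - (1 - δ) c • K` and `(1 - δ) c • K`. -/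
theorem exists_homothet_cover (μ : Measure E) [μ.IsAddHaarMeasure] {B K : Set E}
    (hc : Convex ℝ B) (hB : IsCompact B) (h0 : 0 < μ.real B) (hK : IsCompact K)
    (hKB : K ⊆ B) {x : E} (hxK : {z | z ∈ B ∧ x - z ∈ B} ⊆ K)
    (hx : (5 / 34 : ℝ) ^ finrank ℝ E * μ.real B ≤ μ.real {z | z ∈ B ∧ x - z ∈ B})
    {c δ : ℝ} (hc0 : 0 < c) (hδ0 : 0 < δ) (hδ1 : δ < 1) :
    ∃ (N : ℕ) (y : Fin N → E), B ⊆ (⋃ i, y i +ᵥ c • B) ∧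
      (N : ℝ) ≤ 1 + μ.real (B - ((1 - δ) * c) • K) / (((1 - δ) * c) ^ finrank ℝ E * μ.real K) *
        (finrank ℝ E * Real.log ((1 + 2 / (c * δ)) * (34 / 5))) := by
  set n := finrank ℝ E
  set K₀ : Set E := {z | z ∈ B ∧ x - z ∈ B} with hK₀
  have hK₀c : IsCompact K₀ :=
    hB.inter_right (hB.isClosed.preimage (continuous_const.sub continuous_id))
  have hK₀0 : 0 < μ.real K₀ := lt_of_lt_of_le (by positivity) hx
  have hK0 : 0 < μ.real K := hK₀0.trans_le (measureReal_mono hxK hK.measure_lt_top.ne)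
  set r := c * δ / 2 with hr
  have hr0 : 0 < r := by positivity
  obtain ⟨T, hTB, hTnet, hTcard⟩ := exists_finset_net μ hc hB hK₀c (fun z hz => hz.1) hK₀0 hr0
  have h1δ : 0 < 1 - δ := by linarith
  have hc' : 0 < (1 - δ) * c := by positivity
  set C := ((1 - δ) * c) • K with hC
  have hCc : IsCompact C := hK.smul _
  have hCvol : μ.real C = ((1 - δ) * c) ^ n * μ.real K := measureReal_smul_of_nonneg μ hc'.le K
  have hBne := nonempty_of_measureReal_pos μ h0
  have hTne : T.Nonempty := by
    obtain ⟨b, hb⟩ := hBne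
    obtain ⟨t, ht, -⟩ := hTnet b hb
    exact ⟨t, ht⟩
  obtain ⟨N, y, hy, hN⟩ := exists_translates_cover_finset μ (C := C) (Y := B - C)
    hCc.measurableSet (hB.sub_set hCc).measurableSet (by rw [hCvol]; positivity)
    (measureReal_le_measureReal_sub μ hBne hB hCc) T
    (fun t ht z hz => ⟨t, hTB ht, t - z, hz, by simp⟩) hTne
  refine ⟨N, fun i => y i - r • x, ?_, hN.trans ?_⟩
  · intro b hb
    obtain ⟨t, ht, k, hk, k', hk', rfl⟩ := hTnet b hb
    obtain ⟨i, κ, hκ, hi⟩ := hy t ht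
    simp only at hi
    rw [Set.mem_iUnion]
    refine ⟨i, c • ((1 - δ) • κ + δ • ((1 / 2 : ℝ) • k' + (1 / 2 : ℝ) • (x - k))),
      ⟨_, ?_, rfl⟩, ?_⟩
    · exact hc (hKB hκ) (hc hk'.1 hk.2 (by norm_num) (by norm_num) (by norm_num)) h1δ.le hδ0.le
        (by ring)
    · have ht' : t = y i + ((1 - δ) * c) • κ := by rw [hi]; abel
      rw [ht']
      simp only [vadd_eq_add, hr]
      module
  · rw [hCvol]
    gcongr
    rw [← Real.log_pow]
    refine Real.log_le_log (by exact_mod_cast hTne.card_pos) ?_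
    have h1 : (T.card : ℝ) * (r ^ n * ((5 / 34 : ℝ) ^ n * μ.real B)) ≤
        (1 + r) ^ n * μ.real B :=
      le_trans (by gcongr) hTcard
    have h2 : (T.card : ℝ) * (r * (5 / 34)) ^ n ≤ (1 + r) ^ n := by
      rw [mul_pow]
      refine le_of_mul_le_mul_right ?_ h0
      linarith
    have h3 : (1 + 2 / (c * δ)) * (34 / 5) = (1 + r) / (r * (5 / 34)) := by
      rw [hr]; field_simp; ring
    rw [h3, div_pow, le_div_iff₀ (by positivity)]
    exact h2

/-- Either `B` or its intersection with a point reflection of itself satisfies an exponentially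
better volume bound than the trivial one. -/
theorem exists_subset_measureReal_sub_smul_le (μ : Measure E) [μ.IsAddHaarMeasure] {B : Set E}
    (hc : Convex ℝ B) (hB : IsCompact B) (h0 : 0 < μ.real B)
    {c : ℝ} (hc0 : 0 < c) (hc1 : c ≤ 1) {x : E}
    (hx : (5 / 34 : ℝ) ^ finrank ℝ E * μ.real (B - B) ≤ μ.real {z | z ∈ B ∧ x - z ∈ B}) :
    ∃ K : Set E, IsCompact K ∧ K ⊆ B ∧ {z | z ∈ B ∧ x - z ∈ B} ⊆ K ∧
      μ.real (B - c • K) ≤ (2 * (1 + c) * (998 / 1000)) ^ finrank ℝ E * μ.real K := by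
  set n := finrank ℝ E
  set K₀ : Set E := {z | z ∈ B ∧ x - z ∈ B} with hK₀
  have hK₀c : IsCompact K₀ :=
    hB.inter_right (hB.isClosed.preimage (continuous_const.sub continuous_id))
  by_cases hV : (7 / 2 : ℝ) ^ n * μ.real B ≤ μ.real (B - B)
  · refine ⟨K₀, hK₀c, fun z hz => hz.1, subset_rfl, ?_⟩
    have h1 : μ.real (B - c • K₀) ≤ (1 + c) ^ n * μ.real B := by
      have h2 : B - c • K₀ ⊆ {y | y - (-(c • x)) ∈ (1 + c) • B} := by
        rintro _ ⟨b, hb, _, ⟨k, hk, rfl⟩, rfl⟩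
        simp only [Set.mem_ofPred_eq]
        rw [hc.add_smul zero_le_one hc0.le, one_smul]
        exact ⟨b, hb, c • (x - k), ⟨_, hk.2, rfl⟩, by simp only; module⟩
      have h3 : μ.real {y | y - (-(c • x)) ∈ (1 + c) • B} = μ.real ((1 + c) • B) := by
        rw [measureReal_def, measure_setOf_mem_sub, measureReal_def]
      rw [← measureReal_smul_of_nonneg μ (by positivity), ← h3]
      refine measureReal_mono h2 ?_
      rw [measure_setOf_mem_sub]
      exact (hB.smul _).measure_lt_top.ne
    have h4 : (35 / 68 : ℝ) ^ n * μ.real B ≤ μ.real K₀ := by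
      refine le_trans ?_ hx
      have : (35 / 68 : ℝ) ^ n = (5 / 34 : ℝ) ^ n * (7 / 2 : ℝ) ^ n := by
        rw [← mul_pow]; norm_num
      rw [this, mul_assoc]
      gcongr
    have h5 : (1 + c) ^ n ≤ (2 * (1 + c) * (998 / 1000)) ^ n * (35 / 68 : ℝ) ^ n := by
      rw [← mul_pow]
      refine pow_le_pow_left₀ (by positivity) ?_ _
      linarith
    calc _ ≤ (1 + c) ^ n * μ.real B := h1
      _ ≤ (2 * (1 + c) * (998 / 1000)) ^ n * (35 / 68 : ℝ) ^ n * μ.real B := by gcongr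
      _ = (2 * (1 + c) * (998 / 1000)) ^ n * ((35 / 68 : ℝ) ^ n * μ.real B) := by ring
      _ ≤ _ := by gcongr
  · refine ⟨B, hB, subset_rfl, fun z hz => hz.1, ?_⟩
    push Not at hV
    by_cases hc2 : 81 / 100 ≤ c
    · obtain ⟨b₀, hb₀⟩ := nonempty_of_measureReal_pos μ h0
      have h2 : B - c • B ⊆ {y | y - (1 - c) • b₀ ∈ B - B} := by
        rintro _ ⟨b, hb, _, ⟨k, hk, rfl⟩, rfl⟩
        exact ⟨b, hb, c • k + (1 - c) • b₀, hc hk hb₀ hc0.le (by linarith) (by ring),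
          by simp only; abel⟩
      have h3 : μ.real {y | y - (1 - c) • b₀ ∈ B - B} = μ.real (B - B) := by
        rw [measureReal_def, measure_setOf_mem_sub, measureReal_def]
      have h4 : μ.real (B - c • B) ≤ μ.real (B - B) := by
        rw [← h3]
        refine measureReal_mono h2 ?_
        rw [measure_setOf_mem_sub]
        exact (hB.sub_set hB).measure_lt_top.ne
      refine (h4.trans hV.le).trans ?_
      gcongr
      linarith
    · push Not at hc2
      have h1 := measureReal_sub_sq_smul_le μ hc hB h0 (Real.sqrt_pos.mpr hc0)
      have hs : Real.sqrt c ^ 2 = c := Real.sq_sqrt hc0.le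
      have hs9 : Real.sqrt c ≤ 9 / 10 := by
        rw [Real.sqrt_le_left (by norm_num)]; linarith
      have hs0 := Real.sqrt_nonneg c
      rw [hs] at h1
      refine h1.trans ?_
      gcongr
      nlinarith

end Covering

theorem gCov_le_of_cover {E : Type*} [NormedAddCommGroup E] [NormedSpace ℝ E] {B : Set E}
    {α c : ℝ} (hc0 : 0 < c) (hc1 : c < 1) {N : ℕ} {y : Fin N → E}
    (h : B ⊆ ⋃ i, y i +ᵥ c • B) : gCov α B ≤ N * c ^ α := by
  refine csInf_le ⟨0, ?_⟩ ⟨N, fun _ => c, y, fun _ => ⟨hc0, hc1⟩, h, by simp⟩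
  rintro _ ⟨k, lam, z, hlam, -, rfl⟩
  exact Finset.sum_nonneg fun i _ => Real.rpow_nonneg (hlam i).1.le _

open Module in
theorem gCov_le_of_volume_ratio {E : Type*} [NormedAddCommGroup E] [NormedSpace ℝ E]
    [FiniteDimensional ℝ E] [MeasurableSpace E] [BorelSpace E] (μ : Measure E)
    [μ.IsAddHaarMeasure] {B K : Set E}
    (hc : Convex ℝ B) (hB : IsCompact B) (h0 : 0 < μ.real B) (hK : IsCompact K)
    (hKB : K ⊆ B) {x : E} (hxK : {z | z ∈ B ∧ x - z ∈ B} ⊆ K)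
    (hx : (5 / 34 : ℝ) ^ finrank ℝ E * μ.real B ≤ μ.real {z | z ∈ B ∧ x - z ∈ B})
    {c q α : ℝ} (hc0 : 1 / 100 ≤ c) (hc1 : c < 1) (hq : 1 ≤ q)
    (hvol : μ.real (B - (999 / 1000 * c) • K) ≤
      (q * (999 / 1000 * c)) ^ finrank ℝ E * μ.real K) :
    gCov α B ≤ (1 + 1400000 * finrank ℝ E) * q ^ finrank ℝ E * c ^ α := by
  have hcpos : 0 < c := by linarith
  obtain ⟨N, y, hcov, hN⟩ := exists_homothet_cover μ hc hB h0 hK hKB hxK hx hcpos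
    (δ := 1 / 1000) (by norm_num) (by norm_num)
  refine (gCov_le_of_cover hcpos hc1 hcov).trans ?_
  gcongr
  rw [show (1 - 1 / 1000 : ℝ) = 999 / 1000 by norm_num] at hN
  set n := finrank ℝ E
  have hK0 : 0 < μ.real K :=
    (lt_of_lt_of_le (by positivity) hx).trans_le (measureReal_mono hxK hK.measure_lt_top.ne)
  have h1 : μ.real (B - (999 / 1000 * c) • K) / ((999 / 1000 * c) ^ n * μ.real K) ≤ q ^ n := by
    rw [div_le_iff₀ (by positivity), ← mul_assoc, ← mul_pow]
    exact hvol
  have h2 : 2 / (c * (1 / 1000)) ≤ 200000 := by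
    rw [div_le_iff₀ (by positivity)]; linarith
  have h3 : 0 < 2 / (c * (1 / 1000)) := by positivity
  have h4 : Real.log ((1 + 2 / (c * (1 / 1000))) * (34 / 5)) ≤ 1400000 :=
    (Real.log_le_self (by positivity)).trans (by linarith)
  have h5 : 0 ≤ Real.log ((1 + 2 / (c * (1 / 1000))) * (34 / 5)) :=
    Real.log_nonneg (by linarith)
  have h6 : 1 ≤ q ^ n := one_le_pow₀ hq
  calc (N : ℝ) ≤ 1 + q ^ n * (n * 1400000) := hN.trans (by gcongr)
    _ ≤ _ := by nlinarith

/-- There exist universal constants `c₁, c₂ > 0` such that for every `d ≥ 1`, every convex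
body `B ⊆ ℝ^d`, and every `d/2 < α < d`,
`g_α(B) ≤ c₁ · (d^d / (α^α (d - α)^{d-α})) · 2^d · e^{-c₂ √d}`. -/
theorem gCov_upper_bound_large_alpha :
    ∃ c1 c2 : ℝ, 0 < c1 ∧ 0 < c2 ∧
      ∀ (d : ℕ), 1 ≤ d → ∀ B : Set (EuclideanSpace ℝ (Fin d)), IsConvexBody B →
        ∀ α : ℝ, (d : ℝ) / 2 < α → α < d →
          gCov α B ≤
            c1 * ((d : ℝ) ^ (d : ℝ) / (α ^ α * ((d : ℝ) - α) ^ ((d : ℝ) - α)))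
              * 2 ^ d * Real.exp (-c2 * Real.sqrt d) := by
  refine ⟨1 + 1400000 * 2000, 1 / 2000, by norm_num, by norm_num, ?_⟩
  intro d hd B ⟨hc, hB, hint⟩ α hα hαd
  have hd1 : (1 : ℝ) ≤ d := by exact_mod_cast hd
  have hα0 : 0 < α := by linarith
  have hdα : 0 < (d : ℝ) - α := by linarith
  set M := (d : ℝ) ^ (d : ℝ) / (α ^ α * ((d : ℝ) - α) ^ ((d : ℝ) - α)) with hM
  have hfin : Module.finrank ℝ (EuclideanSpace ℝ (Fin d)) = d := finrank_euclideanSpace_fin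
  let μ : Measure (EuclideanSpace ℝ (Fin d)) := volume
  have h0 : 0 < μ.real B :=
    ENNReal.toReal_pos
      ((isOpen_interior.measure_pos μ hint).trans_le (measure_mono interior_subset)).ne'
      hB.measure_lt_top.ne
  obtain ⟨x, hx⟩ := exists_measureReal_inter_reflection_ge μ hc hB h0 (by rw [hfin]; exact hd)
  have hx' := (mul_le_mul_of_nonneg_left (measureReal_le_measureReal_sub μ
    (nonempty_of_measureReal_pos μ h0) hB hB) (by positivity)).trans hx
  have main : gCov α B ≤ (1 + 1400000 * d) * (999 / 1000 * 2) ^ d * M := by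
    by_cases hα' : 1 / 100 ≤ ((d : ℝ) - α) / α
    · set c := ((d : ℝ) - α) / α with hcdef
      have hc1 : c < 1 := by rw [hcdef, div_lt_one hα0]; linarith
      have hc0 : 0 < c := by linarith
      obtain ⟨K, hK, hKB, hxK, hvol⟩ := exists_subset_measureReal_sub_smul_le μ hc hB h0
        (c := 999 / 1000 * c) (by positivity) (by linarith) hx
      have hqc : 999 / 1000 * 2 * (d / (d - α)) * c = 999 / 1000 * 2 * (1 + c) := by
        rw [hcdef]; field_simp; ring
      have hdd : 1 ≤ (d : ℝ) / (d - α) := by rw [le_div_iff₀ hdα]; linarith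
      have h1 := gCov_le_of_volume_ratio μ hc hB h0 hK hKB hxK hx' hα' hc1
        (q := 999 / 1000 * 2 * (d / (d - α))) (α := α) (by linarith) (hvol.trans
          (mul_le_mul_of_nonneg_right (pow_le_pow_left₀ (by positivity) (by linarith) _)
            measureReal_nonneg))
      rw [hfin] at h1
      refine h1.trans_eq ?_
      rw [hM, hcdef, Real.div_rpow hdα.le hα0.le, Real.rpow_sub hdα, Real.rpow_natCast,
        Real.rpow_natCast, mul_pow _ ((d : ℝ) / (d - α)), div_pow]
      have e1 := Real.rpow_pos_of_pos hα0 α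
      have e2 := Real.rpow_pos_of_pos hdα α
      have e3 : 0 < ((d : ℝ) - α) ^ d := by positivity
      field_simp
    · push Not at hα'
      rw [div_lt_iff₀ hα0] at hα'
      have hs : Real.sqrt (999 / 1000 * (1 / 100)) ≤ 1 / 10 := by
        rw [Real.sqrt_le_left (by norm_num)]; norm_num
      have hs0 := Real.sqrt_nonneg (999 / 1000 * (1 / 100))
      have hvol := measureReal_sub_sq_smul_le μ hc hB h0
        (s := Real.sqrt (999 / 1000 * (1 / 100))) (Real.sqrt_pos.mpr (by norm_num))
      rw [Real.sq_sqrt (by norm_num)] at hvol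
      have h1 := gCov_le_of_volume_ratio μ hc hB h0 hB subset_rfl (fun z hz => hz.1) hx'
        (c := 1 / 100) (q := 122) (α := α) le_rfl (by norm_num) (by norm_num) (hvol.trans (by
          gcongr
          nlinarith))
      rw [hfin] at h1
      refine h1.trans ?_
      have hM1 : 1 ≤ M := by
        rw [hM, one_le_div (by positivity)]
        calc α ^ α * ((d : ℝ) - α) ^ ((d : ℝ) - α)
            ≤ (d : ℝ) ^ α * (d : ℝ) ^ ((d : ℝ) - α) := by
              gcongr
              linarith
          _ = (d : ℝ) ^ (d : ℝ) := by
              rw [← Real.rpow_add (by linarith)]; congr 1; ring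
      have h2 : (1 / 100 : ℝ) ^ α ≤ (11 / 1000) ^ d := by
        calc (1 / 100 : ℝ) ^ α ≤ (1 / 100 : ℝ) ^ ((99 / 100 : ℝ) * d) :=
              Real.rpow_le_rpow_of_exponent_ge (by norm_num) (by norm_num) (by linarith)
          _ = ((1 / 100 : ℝ) ^ (99 / 100 : ℝ)) ^ d := by
              rw [Real.rpow_mul (by norm_num), Real.rpow_natCast]
          _ ≤ (11 / 1000) ^ d := by
              refine pow_le_pow_left₀ (by positivity) ?_ _
              rw [← Real.rpow_le_rpow_iff (z := 100) (by positivity) (by norm_num) (by norm_num),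
                ← Real.rpow_mul (by norm_num)]
              norm_num
      calc (1 + 1400000 * (d : ℝ)) * 122 ^ d * (1 / 100) ^ α
          ≤ (1 + 1400000 * (d : ℝ)) * 122 ^ d * (11 / 1000) ^ d := by gcongr
        _ = (1 + 1400000 * (d : ℝ)) * (122 * (11 / 1000)) ^ d * 1 := by rw [mul_pow]; ring
        _ ≤ (1 + 1400000 * (d : ℝ)) * (999 / 1000 * 2) ^ d * M := by
            refine mul_le_mul (mul_le_mul_of_nonneg_left ?_ (by positivity)) hM1 zero_le_one
              (by positivity)
            exact pow_le_pow_left₀ (by norm_num) (by norm_num) _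
  have hfinal : (1 + 1400000 * (d : ℝ)) * (999 / 1000) ^ d ≤
      (1 + 1400000 * 2000) * Real.exp (-(1 / 2000) * Real.sqrt d) := by
    have h1 : (999 / 1000 : ℝ) ^ d ≤ Real.exp (-(1 / 2000) * d) * Real.exp (-(1 / 2000) * d) := by
      rw [← Real.exp_add, show -(1 / 2000) * (d : ℝ) + -(1 / 2000) * d = d * (-(1 / 1000)) by ring,
        Real.exp_nat_mul]
      refine pow_le_pow_left₀ (by norm_num) ?_ _
      have := Real.add_one_le_exp (-(1 / 1000) : ℝ)
      linarith
    have h2 : Real.exp (-(1 / 2000) * d) ≤ Real.exp (-(1 / 2000) * Real.sqrt d) := by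
      have : Real.sqrt d ≤ d := Real.sqrt_le_iff.mpr ⟨by linarith, by nlinarith⟩
      rw [Real.exp_le_exp]
      linarith
    have h3 : (1 + 1400000 * (d : ℝ)) * Real.exp (-(1 / 2000) * d) ≤ 1 + 1400000 * 2000 := by
      have h4 := Real.add_one_le_exp ((1 / 2000) * (d : ℝ))
      rw [show -(1 / 2000) * (d : ℝ) = -((1 / 2000) * d) by ring, Real.exp_neg,
        ← div_eq_mul_inv, div_le_iff₀ (Real.exp_pos _)]
      nlinarith
    calc (1 + 1400000 * (d : ℝ)) * (999 / 1000) ^ d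
        ≤ (1 + 1400000 * (d : ℝ)) * (Real.exp (-(1 / 2000) * d) * Real.exp (-(1 / 2000) * d)) := by
          gcongr
      _ = (1 + 1400000 * (d : ℝ)) * Real.exp (-(1 / 2000) * d) * Real.exp (-(1 / 2000) * d) := by
          ring
      _ ≤ _ := by gcongr
  have hM0 : 0 ≤ M := by positivity
  calc gCov α B ≤ (1 + 1400000 * d) * (999 / 1000 * 2) ^ d * M := main
    _ = ((1 + 1400000 * (d : ℝ)) * (999 / 1000) ^ d) * (M * 2 ^ d) := by rw [mul_pow]; ring
    _ ≤ ((1 + 1400000 * 2000) * Real.exp (-(1 / 2000) * Real.sqrt d)) * (M * 2 ^ d) := by gcongr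
    _ = _ := by ring
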